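/- For α, β ∈ V*, the quantity π(α,β) := β(σ(p_A(d))) − β(u), computed from any element (d,(u,α)) ∈ F with V*-component α, is independent of the choice of such an element; moreover the resulting map π : V* × V* → ℝ is bilinear and skew-symmetric, i.e. π(α,β) = −π(β,α) for all α, β ∈ V*. (This is the well-definedness and skew-symmetry of the bivector Π_X proved in Section 4.2 of the paper, fibrewise.) -/

import Mathlib

/-- The symmetric bilinear pairing on `E = 𝔻 × (V × V*)`:
`⟪(d₁,(u₁,α₁)),(d₂,(u₂,α₂))⟫ = ⟨d₁,d₂⟩ + (1/2)(α₁(u₂) + α₂(u₁))`. -/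
noncomputable def pairE {D V : Type*} [AddCommGroup D] [Module ℝ D] [AddCommGroup V] [Module ℝ V]
    (B : LinearMap.BilinForm ℝ D) (p q : D × V × Module.Dual ℝ V) : ℝ :=
  B p.1 q.1 + (1 / 2) * (p.2.2 q.2.1 + q.2.2 p.2.1)

/-- If a subspace `F` of `D × V × V*` contains its orthogonal and meets `0 × V × 0` trivially, then
it projects onto `V*`. -/
theorem exists_mem_of_dual {D V : Type*} [AddCommGroup D] [Module ℝ D]
    [AddCommGroup V] [Module ℝ V] [FiniteDimensional ℝ V]
    (B : LinearMap.BilinForm ℝ D) (F : Submodule ℝ (D × V × Module.Dual ℝ V))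
    (hF : ∀ e, (∀ f ∈ F, pairE B e f = 0) → e ∈ F)
    (hFi : ∀ u : V, ((0 : D), u, (0 : Module.Dual ℝ V)) ∈ F → u = 0)
    (α : Module.Dual ℝ V) : ∃ p : D × V, (p.1, p.2, α) ∈ F := by
  let W : Submodule ℝ (Module.Dual ℝ V) :=
    F.map (LinearMap.snd ℝ V (Module.Dual ℝ V) ∘ₗ LinearMap.snd ℝ D (V × Module.Dual ℝ V))
  have hbot : W.dualCoannihilator = ⊥ := by
    refine (Submodule.eq_bot_iff _).2 fun u hu => hFi u (hF _ fun f hf => ?_)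
    have hfu : f.2.2 u = 0 :=
      (Submodule.mem_dualCoannihilator u).1 hu _ (Submodule.mem_map_of_mem hf)
    simp [pairE, hfu]
  have htop : W = ⊤ := by
    rw [← Subspace.dualCoannihilator_dualAnnihilator_eq (W := W), hbot,
      Submodule.dualAnnihilator_bot]
  obtain ⟨⟨d, u, _⟩, hf, rfl⟩ : α ∈ W := htop ▸ Submodule.mem_top
  exact ⟨(d, u), hf⟩

/-- A symmetric form for which both summands of `D = A ⊕ B₀` are isotropic is recovered from its
mixed terms. -/
theorem apply_eq_add_of_isotropic_isCompl {D : Type*} [AddCommGroup D] [Module ℝ D]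
    (B : LinearMap.BilinForm ℝ D) (hBsymm : B.IsSymm) (A B₀ : Submodule ℝ D)
    (hA : ∀ a ∈ A, ∀ a' ∈ A, B a a' = 0) (hB₀ : ∀ b ∈ B₀, ∀ b' ∈ B₀, B b b' = 0)
    (hcompl : IsCompl A B₀) (pA : D →ₗ[ℝ] A) (hpA1 : ∀ a : A, pA (a : D) = a)
    (hpA2 : ∀ b ∈ B₀, pA b = 0) (d e : D) :
    B d e = B (pA d) e + B (pA e) d := by
  have decomp (x : D) : ∃ a ∈ A, ∃ b ∈ B₀, x = a + b ∧ (pA x : D) = a := by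
    obtain ⟨a, ha, b, hb, rfl⟩ :=
      Submodule.mem_sup.1 (hcompl.sup_eq_top ▸ Submodule.mem_top : x ∈ A ⊔ B₀)
    exact ⟨a, ha, b, hb, rfl, by rw [map_add, hpA2 b hb, add_zero, hpA1 ⟨a, ha⟩]⟩
  obtain ⟨a, ha, b, hb, rfl, hd⟩ := decomp d
  obtain ⟨a', ha', b', hb', rfl, he⟩ := decomp e
  rw [hd, he]
  simp only [map_add, LinearMap.add_apply, hA a ha a' ha', hA a' ha' a ha, hB₀ b hb b' hb']
  linear_combination hBsymm.eq b a'

theorem stmt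
    {D V : Type*} [AddCommGroup D] [Module ℝ D] [FiniteDimensional ℝ D]
    [AddCommGroup V] [Module ℝ V] [FiniteDimensional ℝ V]
    (B : LinearMap.BilinForm ℝ D) (hBsymm : B.IsSymm) (hBnd : B.Nondegenerate)
    (A : Submodule ℝ D)
    -- `A = A^⊥` (A is Lagrangian in 𝔻)
    (hA : (A : Set D) = {d : D | ∀ a ∈ A, B d a = 0})
    (F : Submodule ℝ (D × V × Module.Dual ℝ V))
    -- `F = F^⊥` with respect to the pairing `pairE B` (F is Lagrangian in E)
    (hF : (F : Set (D × V × Module.Dual ℝ V)) =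
      {e : D × V × Module.Dual ℝ V | ∀ f ∈ F, pairE B e f = 0})
    -- (i) `F` intersects `{0} × (V × {0})` trivially
    (hFi : ∀ u : V, ((0 : D), u, (0 : Module.Dual ℝ V)) ∈ F → u = 0)
    -- (ii) the image of `F ∩ (𝔻 × (V × {0}))` under the projection `E → 𝔻` equals `A`
    (hFii : ∀ d : D, d ∈ A ↔ ∃ u : V, (d, u, (0 : Module.Dual ℝ V)) ∈ F)
    -- `σ : A → V` assigns to each `a ∈ A` the (unique) `u` with `(a,(u,0)) ∈ F`
    (σ : A → V) (hσ : ∀ a : A, ((a : D), σ a, (0 : Module.Dual ℝ V)) ∈ F)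
    -- `B₀` is an isotropic complement of `A` in `𝔻`
    (B₀ : Submodule ℝ D) (hB₀iso : ∀ b ∈ B₀, ∀ b' ∈ B₀, B b b' = 0)
    (hcompl : IsCompl A B₀)
    -- `pA : 𝔻 → A` is the projection with kernel `B₀`
    (pA : D →ₗ[ℝ] A) (hpA1 : ∀ a : A, pA (a : D) = a) (hpA2 : ∀ b ∈ B₀, pA b = 0)
    :
    ∃ π : Module.Dual ℝ V → Module.Dual ℝ V → ℝ,
      -- `π(α,β) = β(σ(p_A d)) − β(u)` for any `(d,(u,α)) ∈ F` (well-definedness)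
      (∀ (α β : Module.Dual ℝ V) (d : D) (u : V), (d, u, α) ∈ F →
        π α β = β (σ (pA d)) - β u) ∧
      -- bilinearity
      (∀ β : Module.Dual ℝ V, IsLinearMap ℝ fun α => π α β) ∧
      (∀ α : Module.Dual ℝ V, IsLinearMap ℝ (π α)) ∧
      -- skew-symmetry
      (∀ α β : Module.Dual ℝ V, π α β = - π β α) := by
  have hiso (e f) (he : e ∈ F) (hf : f ∈ F) : pairE B e f = 0 :=
    (hF ▸ he : e ∈ {e | ∀ f ∈ F, pairE B e f = 0}) f hf
  have hAiso : ∀ a ∈ A, ∀ a' ∈ A, B a a' = 0 := fun a ha =>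
    (hA ▸ ha : a ∈ {d : D | ∀ a ∈ A, B d a = 0})
  have skew {α β d e u v} (hd : (d, u, α) ∈ F) (he : (e, v, β) ∈ F) :
      β (σ (pA d)) - β u = -(α (σ (pA e)) - α v) := by
    have h₁ := hiso _ _ hd he
    have h₂ := hiso _ _ (hσ (pA d)) he
    have h₃ := hiso _ _ (hσ (pA e)) hd
    have h₄ := apply_eq_add_of_isotropic_isCompl B hBsymm A B₀ hAiso hB₀iso hcompl pA hpA1 hpA2 d e
    simp only [pairE, LinearMap.zero_apply, zero_add] at h₁ h₂ h₃
    linarith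
  choose p hp using exists_mem_of_dual B F
    (fun e he => (hF ▸ he : e ∈ (F : Set (D × V × Module.Dual ℝ V)))) hFi
  have linear (α : Module.Dual ℝ V) :
      IsLinearMap ℝ fun β : Module.Dual ℝ V => β (σ (pA (p α).1)) - β (p α).2 :=
    ⟨fun β γ => by simp only [LinearMap.add_apply]; ring,
      fun c β => by simp only [LinearMap.smul_apply, smul_eq_mul]; ring⟩
  refine ⟨fun α β => β (σ (pA (p α).1)) - β (p α).2, fun α β d u h => ?_, fun β => ?_, linear,
    fun α β => skew (hp α) (hp β)⟩
  · exact (skew (hp α) (hp β)).trans (skew h (hp β)).symm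
  · simp only [fun α => skew (hp α) (hp β)]
    exact (-(linear β).mk').isLinear
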